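/- Let H=(V,E) be a hypergraph and B ⊆ V a set such that every vertex of B belongs to at least one edge of E. Then sup{ h(B) : h is an edge-dominated polymatroid on V } = ρ*_E(B), the fractional edge cover number of B; moreover the same value equals the supremum taken over edge-dominated E-polymatroids and the supremum taken over nonnegative edge-dominated modular set functions. -/

import Mathlib

/-- A polymatroid on a finite set `V`. -/
def IsPolymatroid {V : Type} [Fintype V] [DecidableEq V] (h : Finset V → ℝ) : Prop :=
  (∀ S : Finset V, 0 ≤ h S) ∧ h ∅ = 0 ∧
    (∀ X Y : Finset V, X ⊆ Y → h X ≤ h Y) ∧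
    (∀ X Y : Finset V, h (X ∪ Y) + h (X ∩ Y) ≤ h X + h Y)

/-- An `E`-polymatroid on a finite set `V`. -/
def IsEPolymatroid {V : Type} [Fintype V] [DecidableEq V]
    (E : Finset (Finset V)) (h : Finset V → ℝ) : Prop :=
  (∀ S : Finset V, 0 ≤ h S) ∧ h ∅ = 0 ∧
    (∀ X Y : Finset V, X ⊆ Y → h X ≤ h Y) ∧
    (∀ X Y : Finset V, (∃ S ∈ E, X ∩ Y ⊆ S) → h (X ∪ Y) + h (X ∩ Y) ≤ h X + h Y)

/-- Edge-dominated: at most `1` on every edge. -/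
def EdgeDominated {V : Type} [Fintype V] [DecidableEq V]
    (E : Finset (Finset V)) (h : Finset V → ℝ) : Prop :=
  ∀ S ∈ E, h S ≤ 1

/-- Modular set function. -/
def IsModular {V : Type} [Fintype V] [DecidableEq V] (h : Finset V → ℝ) : Prop :=
  ∀ S : Finset V, h S = ∑ v ∈ S, h {v}

/-- Values of feasible fractional edge covers of `B`; `ρ*_E(B)` is their infimum. -/
def fracEdgeCoverValues {V : Type} [Fintype V] [DecidableEq V]
    (E : Finset (Finset V)) (B : Finset V) : Set ℝ :=
  { r : ℝ | ∃ y : Finset V → ℝ, (∀ S : Finset V, 0 ≤ y S) ∧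
      (∀ v ∈ B, 1 ≤ ∑ S ∈ E.filter (fun S => v ∈ S), y S) ∧
      r = ∑ S ∈ E, y S }

/-- An `E`-polymatroid is dominated on edges by a nonnegative weight with the same value at `B`. -/
theorem IsEPolymatroid.exists_weight {V : Type} [Fintype V] [DecidableEq V]
    {E : Finset (Finset V)} {h : Finset V → ℝ} (hh : IsEPolymatroid E h) (B : Finset V) :
    ∃ g : V → ℝ, (∀ v, 0 ≤ g v) ∧ (∀ v ∉ B, g v = 0) ∧ ∑ v ∈ B, g v = h B ∧
      ∀ S ∈ E, ∑ v ∈ S, g v ≤ h (S ∩ B) := by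
  obtain ⟨-, hempty, hmono, hsub⟩ := hh
  induction B using Finset.induction_on with
  | empty => exact ⟨0, by simp, by simp, by simp [hempty], by simp [hempty]⟩
  | insert a B ha ih =>
    obtain ⟨g, hg0, hgB, hgsum, hgE⟩ := ih
    refine ⟨g + Pi.single a (h (insert a B) - h B), fun v => ?_, fun v hv => ?_, ?_,
      fun S hS => ?_⟩
    · refine add_nonneg (hg0 v) ?_
      rcases eq_or_ne v a with rfl | hva
      · simpa using hmono _ _ (Finset.subset_insert v B)
      · simp [hva]
    · simp only [Finset.mem_insert, not_or] at hv
      simp [hgB v hv.2, hv.1]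
    · simp [Finset.sum_add_distrib, Finset.sum_insert ha, hgB a ha, hgsum, Pi.single_apply, ha]
    · simp only [Pi.add_apply, Finset.sum_add_distrib, Finset.sum_pi_single']
      by_cases haS : a ∈ S
      · have key := hsub (S ∩ insert a B) B ⟨S, hS, fun v hv => by
          simp only [Finset.mem_inter] at hv; exact hv.1.1⟩
        have hunion : S ∩ insert a B ∪ B = insert a B := by grind
        have hinter : S ∩ insert a B ∩ B = S ∩ B := by grind
        rw [hunion, hinter] at key
        have := hgE S hS
        simp only [haS, if_true]
        linarith
      · simpa [haS, Finset.inter_insert_of_notMem haS] using hgE S hS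

/-- Nonnegative modular set functions are polymatroids. -/
theorem IsModular.isPolymatroid {V : Type} [Fintype V] [DecidableEq V] {h : Finset V → ℝ}
    (hmod : IsModular h) (h0 : ∀ S, 0 ≤ h S) : IsPolymatroid h := by
  refine ⟨h0, by simpa using hmod ∅, fun X Y hXY => ?_, fun X Y => ?_⟩
  · rw [hmod X, hmod Y]
    exact Finset.sum_le_sum_of_subset_of_nonneg hXY fun v _ _ => h0 _
  · rw [hmod (X ∪ Y), hmod (X ∩ Y), hmod X, hmod Y, Finset.sum_union_inter]

/-- Polymatroids are `E`-polymatroids. -/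
theorem IsPolymatroid.isEPolymatroid {V : Type} [Fintype V] [DecidableEq V] {h : Finset V → ℝ}
    (hh : IsPolymatroid h) (E : Finset (Finset V)) : IsEPolymatroid E h :=
  ⟨hh.1, hh.2.1, hh.2.2.1, fun X Y _ => hh.2.2.2 X Y⟩

/-- The set function with a given nonnegative vertex weight is modular. -/
theorem isModular_sum {V : Type} [Fintype V] [DecidableEq V] (g : V → ℝ) :
    IsModular fun S : Finset V => ∑ v ∈ S, g v := fun S => by simp

/-- An edge-dominated `E`-polymatroid can be replaced by an edge-dominated nonnegative modular
function with the same value at `B`. -/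
theorem IsEPolymatroid.exists_isModular {V : Type} [Fintype V] [DecidableEq V]
    {E : Finset (Finset V)} {h : Finset V → ℝ} (hh : IsEPolymatroid E h)
    (hdom : EdgeDominated E h) (B : Finset V) :
    ∃ k : Finset V → ℝ, (∀ S, 0 ≤ k S) ∧ IsModular k ∧ EdgeDominated E k ∧ h B = k B := by
  obtain ⟨g, hg0, -, hgB, hgE⟩ := hh.exists_weight B
  exact ⟨fun S => ∑ v ∈ S, g v, fun S => Finset.sum_nonneg fun v _ => hg0 v, isModular_sum g,
    fun S hS => (hgE S hS).trans ((hh.2.2.1 _ _ Finset.inter_subset_left).trans (hdom S hS)),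
    hgB.symm⟩

/-- Weak duality between fractional edge packings and fractional edge covers. -/
theorem sum_weight_le_of_fractional_cover {V : Type} [Fintype V] [DecidableEq V]
    {E : Finset (Finset V)} {B : Finset V} {g : V → ℝ} (hg0 : ∀ v, 0 ≤ g v)
    (hgE : ∀ S ∈ E, ∑ v ∈ S, g v ≤ 1) {r : ℝ} (hr : r ∈ fracEdgeCoverValues E B) :
    ∑ v ∈ B, g v ≤ r := by
  obtain ⟨y, hy0, hyB, rfl⟩ := hr
  calc ∑ v ∈ B, g v
      ≤ ∑ v ∈ B, g v * ∑ S ∈ E with v ∈ S, y S :=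
        Finset.sum_le_sum fun v hv => le_mul_of_one_le_right (hg0 v) (hyB v hv)
    _ ≤ ∑ v, g v * ∑ S ∈ E with v ∈ S, y S :=
        Finset.sum_le_sum_of_subset_of_nonneg (Finset.subset_univ B) fun v _ _ =>
          mul_nonneg (hg0 v) (Finset.sum_nonneg fun S _ => hy0 S)
    _ = ∑ S ∈ E, y S * ∑ v ∈ S, g v := by
        simp_rw [Finset.mul_sum, Finset.sum_filter]
        rw [Finset.sum_comm]
        refine Finset.sum_congr rfl fun S _ => ?_
        rw [← Finset.sum_filter, Finset.filter_univ_mem]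
        exact Finset.sum_congr rfl fun v _ => mul_comm _ _
    _ ≤ ∑ S ∈ E, y S :=
        Finset.sum_le_sum fun S hS => mul_le_of_le_one_right (hy0 S) (hgE S hS)

/-- Strong duality: a lower bound `r` on all fractional edge covers of `B` is attained by a
fractional packing of weight at least `r`. -/
theorem exists_weight_of_le_fractional_covers {V : Type} [Fintype V] [DecidableEq V]
    {E : Finset (Finset V)} {B : Finset V} (hcov : ∀ v ∈ B, ∃ S ∈ E, v ∈ S) {r : ℝ}
    (hr : ∀ x ∈ fracEdgeCoverValues E B, r ≤ x) :
    ∃ g : V → ℝ, (∀ v, 0 ≤ g v) ∧ (∀ S ∈ E, ∑ v ∈ S, g v ≤ 1) ∧ r ≤ ∑ v ∈ B, g v := by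
  let A : (Finset V → ℝ) → V → ℝ := fun y v => ∑ S ∈ E with v ∈ S, y S
  let C : Set ((V → ℝ) × ℝ) :=
    {c | ∃ y : Finset V → ℝ, (∀ S, 0 ≤ y S) ∧ (∀ v, c.1 v < A y v) ∧ ∑ S ∈ E, y S < c.2}
  let p : (V → ℝ) × ℝ := (fun v => if v ∈ B then 1 else -1, r)
  have hCopen : IsOpen C := by
    have hC : C = ⋃ y ∈ {y : Finset V → ℝ | ∀ S, 0 ≤ y S},
        ((⋂ v, {c : (V → ℝ) × ℝ | c.1 v < A y v}) ∩ {c | ∑ S ∈ E, y S < c.2}) := by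
      ext c; simp [C, and_left_comm]
    rw [hC]
    exact isOpen_biUnion fun y _ =>
      (isOpen_iInter_of_finite fun v => isOpen_lt (by fun_prop) (by fun_prop)).inter
        (isOpen_lt (by fun_prop) (by fun_prop))
  have hA : ∀ (a b : ℝ) (y z : Finset V → ℝ) v, A (a • y + b • z) v = a * A y v + b * A z v := by
    intro a b y z v
    simp [A, Finset.sum_add_distrib, Finset.mul_sum]
  have hCconv : Convex ℝ C := by
    rw [convex_iff_forall_pos]
    rintro c ⟨y, hy0, hyv, hys⟩ d ⟨z, hz0, hzv, hzs⟩ a b ha hb -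
    refine ⟨a • y + b • z, fun S => ?_, fun v => ?_, ?_⟩
    · exact add_nonneg (mul_nonneg ha.le (hy0 S)) (mul_nonneg hb.le (hz0 S))
    · rw [hA]
      exact add_lt_add (mul_lt_mul_of_pos_left (hyv v) ha) (mul_lt_mul_of_pos_left (hzv v) hb)
    · simp only [Pi.add_apply, Pi.smul_apply, smul_eq_mul, Finset.sum_add_distrib,
        ← Finset.mul_sum]
      exact add_lt_add (mul_lt_mul_of_pos_left hys ha) (mul_lt_mul_of_pos_left hzs hb)
  have hpC : p ∉ C := by
    rintro ⟨y, hy0, hyv, hys⟩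
    refine (hr _ ⟨y, hy0, fun v hv => ?_, rfl⟩).not_gt hys
    simpa [p, hv] using (hyv v).le
  obtain ⟨f, hf⟩ := geometric_hahn_banach_open_point hCconv hCopen hpC
  have hclosed : ∀ (y : Finset V → ℝ) (x : (V → ℝ) × ℝ), (∀ S, 0 ≤ y S) →
      (∀ v, x.1 v ≤ A y v) → ∑ S ∈ E, y S ≤ x.2 → f x ≤ f p := by
    intro y x hy0 hyv hys
    have hlim : Filter.Tendsto (fun ε : ℝ => f (x + ε • ((fun _ => -1, 1) : (V → ℝ) × ℝ)))
        (nhdsWithin 0 (Set.Ioi 0)) (nhds (f x)) := by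
      refine Filter.Tendsto.mono_left ?_ nhdsWithin_le_nhds
      have : Continuous fun ε : ℝ => f (x + ε • ((fun _ => -1, 1) : (V → ℝ) × ℝ)) := by
        fun_prop
      simpa using this.tendsto 0
    refine le_of_tendsto hlim (Filter.eventually_of_mem self_mem_nhdsWithin fun ε hε => ?_)
    have hε' : 0 < ε := hε
    refine (hf _ ⟨y, hy0, fun v => ?_, ?_⟩).le
    · have := hyv v
      simp only [Prod.fst_add, Prod.smul_fst, Pi.add_apply, Pi.smul_apply, smul_eq_mul]
      linarith
    · simp only [Prod.snd_add, Prod.smul_snd, smul_eq_mul]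
      linarith
  have hp0 : 0 ≤ f p := by
    simpa using hclosed 0 0 (by simp) (by simp [A]) (by simp)
  have hcone : ∀ (y : Finset V → ℝ) (x : (V → ℝ) × ℝ), (∀ S, 0 ≤ y S) →
      (∀ v, x.1 v ≤ A y v) → ∑ S ∈ E, y S ≤ x.2 → f x ≤ 0 := by
    intro y x hy0 hyv hys
    by_contra! hx
    obtain ⟨n, hn⟩ := exists_nat_gt (f p / f x)
    rw [div_lt_iff₀ hx] at hn
    have := hclosed ((n : ℝ) • y) ((n : ℝ) • x)
      (fun S => mul_nonneg n.cast_nonneg (hy0 S)) (fun v => by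
        have hAn := hA n 0 y 0 v
        simp only [smul_zero, add_zero, zero_mul] at hAn
        rw [hAn]
        exact mul_le_mul_of_nonneg_left (hyv v) n.cast_nonneg) (by
        simp only [Pi.smul_apply, smul_eq_mul, ← Finset.mul_sum]
        exact mul_le_mul_of_nonneg_left hys n.cast_nonneg)
    rw [map_smul, smul_eq_mul] at this
    linarith
  let a : V → ℝ := fun v => f (Pi.single v 1, 0)
  let τ : ℝ := f (0, 1)
  have hfx : ∀ (z : V → ℝ) (t : ℝ), f (z, t) = ∑ v, z v * a v + t * τ := by
    intro z t
    have hdecomp : ((z, t) : (V → ℝ) × ℝ) =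
        ∑ v, z v • ((Pi.single v 1, 0) : (V → ℝ) × ℝ) + t • ((0, 1) : (V → ℝ) × ℝ) := by
      ext i
      · simp [Prod.fst_sum, Finset.sum_apply, Pi.single_apply]
      · simp [Prod.snd_sum]
    rw [hdecomp, map_add, map_sum, map_smul]
    simp only [map_smul, smul_eq_mul, a, τ]
  have ha0 : ∀ v, 0 ≤ a v := by
    intro v
    have := hcone 0 (-(Pi.single v 1, 0)) (by simp) (fun w => by
      by_cases hw : w = v <;> simp [A, hw]) (by simp)
    rw [map_neg] at this
    linarith
  have hτ : τ ≤ 0 := hcone 0 (0, 1) (by simp) (by simp [A]) (by simp)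
  have haE : ∀ S ∈ E, ∑ v ∈ S, a v ≤ -τ := by
    intro S hS
    have := hcone (Pi.single S 1) (fun v => if v ∈ S then 1 else 0, 1)
      (fun T => by by_cases hT : T = S <;> simp [hT])
      (fun v => by simp [A, hS]) (by simp [hS])
    rw [hfx] at this
    simp only [ite_mul, one_mul, zero_mul, ← Finset.sum_filter, Finset.filter_univ_mem] at this
    linarith
  have hpB : 0 ≤ ∑ v ∈ B, a v - ∑ v ∈ Bᶜ, a v + r * τ := by
    have hsplit : f p = ∑ v ∈ B, a v - ∑ v ∈ Bᶜ, a v + r * τ := by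
      rw [show f p = _ from hfx _ _, ← Finset.sum_add_sum_compl B, sub_eq_add_neg,
        ← Finset.sum_neg_distrib]
      congr 2
      · exact Finset.sum_congr rfl fun v hv => by simp [hv]
      · exact Finset.sum_congr rfl fun v hv => by simp [Finset.mem_compl.mp hv]
    rwa [← hsplit]
  have hBc : 0 ≤ ∑ v ∈ Bᶜ, a v := Finset.sum_nonneg fun v _ => ha0 v
  have hτneg : τ < 0 := by
    refine lt_of_le_of_ne hτ fun hτ0 => ?_
    have haB : ∀ v ∈ B, a v = 0 := by
      intro v hv
      obtain ⟨S, hS, hvS⟩ := hcov v hv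
      have := haE S hS
      have := Finset.single_le_sum (fun w _ => ha0 w) hvS
      linarith [ha0 v]
    rw [Finset.sum_eq_zero haB, hτ0] at hpB
    have ha : ∀ v, a v = 0 := by
      intro v
      by_cases hv : v ∈ B
      · exact haB v hv
      · have := Finset.single_le_sum (fun w _ => ha0 w) (Finset.mem_compl.mpr hv)
        linarith [ha0 v]
    have hfzero : ∀ x, f x = 0 := fun x => by
      rw [show f x = _ from hfx x.1 x.2]; simp [ha, hτ0]
    have := hf (fun _ => -1, 1) ⟨0, by simp, by simp [A], by simp⟩
    simp [hfzero] at this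
  refine ⟨fun v => a v / -τ, fun v => div_nonneg (ha0 v) (by linarith), fun S hS => ?_, ?_⟩
  · rw [← Finset.sum_div, div_le_one (by linarith)]
    exact haE S hS
  · rw [← Finset.sum_div, le_div_iff₀ (by linarith)]
    linarith

/-- The supremum over nonnegative edge-dominated modular functions is the fractional edge cover
number. -/
theorem sSup_modular_eq_fractional_edge_cover {V : Type} [Fintype V] [DecidableEq V]
    {E : Finset (Finset V)} {B : Finset V} (hcov : ∀ v ∈ B, ∃ S ∈ E, v ∈ S) :
    sSup { r : ℝ | ∃ h : Finset V → ℝ, (∀ S : Finset V, 0 ≤ h S) ∧ IsModular h ∧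
          EdgeDominated E h ∧ r = h B } = sInf (fracEdgeCoverValues E B) := by
  have hne : (fracEdgeCoverValues E B).Nonempty := by
    refine ⟨_, fun _ => 1, fun _ => zero_le_one, fun v hv => ?_, rfl⟩
    obtain ⟨S, hS, hvS⟩ := hcov v hv
    exact Finset.single_le_sum (f := fun _ => (1 : ℝ)) (fun _ _ => zero_le_one)
      (Finset.mem_filter.mpr ⟨hS, hvS⟩)
  have hbdd : BddBelow (fracEdgeCoverValues E B) :=
    ⟨0, by rintro _ ⟨y, hy0, -, rfl⟩; exact Finset.sum_nonneg fun S _ => hy0 S⟩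
  have hweight : ∃ g : V → ℝ, (∀ v, 0 ≤ g v) ∧ (∀ S ∈ E, ∑ v ∈ S, g v ≤ 1) ∧
      sInf (fracEdgeCoverValues E B) ≤ ∑ v ∈ B, g v :=
    exists_weight_of_le_fractional_covers hcov fun x hx => csInf_le hbdd hx
  obtain ⟨g, hg0, hgE, hgB⟩ := hweight
  have hg : ∑ v ∈ B, g v = sInf (fracEdgeCoverValues E B) :=
    (le_csInf hne fun r hr => sum_weight_le_of_fractional_cover hg0 hgE hr).antisymm hgB
  refine IsGreatest.csSup_eq ⟨⟨fun S => ∑ v ∈ S, g v,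
    fun S => Finset.sum_nonneg fun v _ => hg0 v, isModular_sum g, hgE, hg.symm⟩, ?_⟩
  rintro _ ⟨h, h0, hmod, hdom, rfl⟩
  refine le_csInf hne fun r hr => ?_
  rw [hmod B]
  exact sum_weight_le_of_fractional_cover (fun v => h0 {v})
    (fun S hS => by rw [← hmod S]; exact hdom S hS) hr

/-- LP duality: the supremum of `h(B)` over edge-dominated polymatroids equals `ρ*_E(B)`,
and the same value is obtained over edge-dominated `E`-polymatroids and over nonnegative
edge-dominated modular set functions. -/
theorem sup_polymatroid_eq_fractional_edge_cover
    (V : Type) [Fintype V] [DecidableEq V] (E : Finset (Finset V))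
    (B : Finset V) (hcov : ∀ v ∈ B, ∃ S ∈ E, v ∈ S) :
    sSup { r : ℝ | ∃ h : Finset V → ℝ, IsPolymatroid h ∧ EdgeDominated E h ∧ r = h B }
        = sInf (fracEdgeCoverValues E B) ∧
    sSup { r : ℝ | ∃ h : Finset V → ℝ, IsEPolymatroid E h ∧ EdgeDominated E h ∧ r = h B }
        = sInf (fracEdgeCoverValues E B) ∧
    sSup { r : ℝ | ∃ h : Finset V → ℝ, (∀ S : Finset V, 0 ≤ h S) ∧ IsModular h ∧
          EdgeDominated E h ∧ r = h B }
        = sInf (fracEdgeCoverValues E B) := by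
  have hmodular := sSup_modular_eq_fractional_edge_cover hcov
  refine ⟨?_, ?_, hmodular⟩ <;> rw [← hmodular] <;> congr 1 <;> ext r <;> constructor
  · rintro ⟨h, hh, hdom, rfl⟩
    exact (hh.isEPolymatroid E).exists_isModular hdom B
  · rintro ⟨h, h0, hmod, hdom, rfl⟩
    exact ⟨h, hmod.isPolymatroid h0, hdom, rfl⟩
  · rintro ⟨h, hh, hdom, rfl⟩
    exact hh.exists_isModular hdom B
  · rintro ⟨h, h0, hmod, hdom, rfl⟩
    exact ⟨h, (hmod.isPolymatroid h0).isEPolymatroid E, hdom, rfl⟩
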